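/- Let G be a finite simple graph of order n, let (X_v)_{v∈V(G)} be a (G,φ)-mixing process in which every X_v takes values in a bounded interval of length Δ, fix d ∈ {1,…,n}, and let {(w_k,S_k)}_{k=1}^K be a d-stable fractional partition of G with total weight W = ∑_k w_k. Then for every t > φ_d, P( (1/n)·∑_{v∈V(G)} X_v ≥ t ) ≤ exp( −2n·(t − φ_d)² / (Δ²·W) ). -/

import Mathlib

open MeasureTheory

lemma two_point (a Δ m l : ℝ) (hΔ : 0 < Δ) (hm : m ∈ Set.Icc a (a + Δ)) (hl : 0 ≤ l) :
    ∃ α β : ℝ, 0 ≤ β ∧ (∀ x ∈ Set.Icc a (a + Δ), Real.exp (l * x) ≤ α + β * x) ∧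
      α + β * m ≤ Real.exp (l * m + l ^ 2 * Δ ^ 2 / 8) := by
  set A := Real.exp (l * a) with hA
  set B := Real.exp (l * (a + Δ)) with hB
  have hAB : A ≤ B := Real.exp_le_exp.2 (by nlinarith)
  have hchord : ∀ x ∈ Set.Icc a (a + Δ), Real.exp (l * x) ≤ (A - (B - A) / Δ * a) + (B - A) / Δ * x := by
    intro x hx
    have g0 : 0 ≤ 1 - (x - a) / Δ := by rw [sub_nonneg, div_le_one hΔ]; linarith [hx.2]
    have g1 : 0 ≤ (x - a) / Δ := div_nonneg (by linarith [hx.1]) hΔ.le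
    have h := convexOn_exp.2 (Set.mem_univ (l * a)) (Set.mem_univ (l * (a + Δ))) g0 g1 (by ring)
    simp only [smul_eq_mul] at h
    have e1 : (1 - (x - a) / Δ) * (l * a) + (x - a) / Δ * (l * (a + Δ)) = l * x := by
      field_simp; ring
    rw [e1] at h
    refine h.trans (le_of_eq ?_)
    rw [← hA, ← hB]; field_simp; ring
  refine ⟨A - (B - A) / Δ * a, (B - A) / Δ, div_nonneg (by linarith) hΔ.le, hchord, ?_⟩
  set p := (m - a) / Δ with hp
  have hp0 : 0 ≤ p := div_nonneg (by linarith [hm.1]) hΔ.le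
  have hp1 : 0 ≤ 1 - p := by rw [hp, sub_nonneg, div_le_one hΔ]; linarith [hm.2]
  let ν : Measure ℝ := ENNReal.ofReal (1 - p) • Measure.dirac a + ENNReal.ofReal p • Measure.dirac (a + Δ)
  have hν : IsProbabilityMeasure ν := ⟨by
    simp [ν, ← ENNReal.ofReal_add hp1 hp0]⟩
  have hint : ∀ f : ℝ → ℝ, ∫ x, f x ∂ν = (1 - p) * f a + p * f (a + Δ) := by
    intro f
    have hi : ∀ (c : ℝ) (y : ℝ), Integrable f (ENNReal.ofReal c • Measure.dirac y) := fun c y =>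
      (integrable_dirac (by simp)).smul_measure ENNReal.ofReal_ne_top
    rw [integral_add_measure (hi _ _) (hi _ _), integral_smul_measure, integral_smul_measure]
    simp [ENNReal.toReal_ofReal hp0, ENNReal.toReal_ofReal hp1]
  have hae : ∀ᵐ x ∂ν, id x ∈ Set.Icc a (a + Δ) := by
    have h1 : ∀ (c : ℝ) (y : ℝ), y ∈ Set.Icc a (a + Δ) → 
      ∀ᵐ x ∂(ENNReal.ofReal c • Measure.dirac y), id x ∈ Set.Icc a (a + Δ) := by
      intro c y hy
      refine Measure.ae_smul_measure ?_ _
      rw [ae_dirac_eq]; exact hy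
    rw [ae_add_measure_iff]
    exact ⟨h1 _ _ (by simp [hΔ.le]), h1 _ _ (by simp [hΔ.le])⟩
  have hH := (ProbabilityTheory.hasSubgaussianMGF_of_mem_Icc (μ := ν) aemeasurable_id hae).mgf_le l
  have hmean : ∫ x, id x ∂ν = m := by rw [hint]; simp [hp]; field_simp; ring
  rw [hmean] at hH
  simp only [ProbabilityTheory.mgf] at hH
  rw [hint] at hH
  have e2 : ((A - (B - A) / Δ * a) + (B - A) / Δ * m) = Real.exp (l * m) * ((1 - p) * Real.exp (l * (id a - m)) + p * Real.exp (l * (id (a + Δ) - m))) := by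
    have h3 : ∀ y, Real.exp (l * (y - m)) = Real.exp (l * y) * Real.exp (- (l * m)) := by
      intro y; rw [← Real.exp_add]; ring_nf
    simp only [id, h3, ← hA, ← hB]
    have h4 : Real.exp (l * m) * Real.exp (-(l*m)) = 1 := by rw [← Real.exp_add]; simp
    have : Real.exp (l * m) * ((1 - p) * (A * Real.exp (-(l*m))) + p * (B * Real.exp (-(l*m)))) = (Real.exp (l * m) * Real.exp (-(l*m))) * ((1 - p) * A + p * B) := by ring
    rw [this, h4, hp]; field_simp; ring
  rw [e2, Real.exp_add]
  refine mul_le_mul_of_nonneg_left (hH.trans (le_of_eq ?_)) (Real.exp_pos _).le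
  congr 1
  simp [abs_of_pos hΔ]
  ring

lemma step {Ω : Type*} {m m0 : MeasurableSpace Ω} (hm : m ≤ m0) (μ : Measure Ω)
    [IsProbabilityMeasure μ] (X Z : Ω → ℝ) (hX : Measurable X) (a Δ f l : ℝ) (hΔ : 0 < Δ)
    (hb : ∀ ω, X ω ∈ Set.Icc a (a + Δ)) (hc : ∫ ω, X ω ∂μ = 0) (hf : 0 ≤ f)
    (hmix : ∀ᵐ ω ∂μ, (μ[X | m]) ω ≤ f) (hl : 0 ≤ l)
    (hZ : Measurable[m] Z) (hZ0 : ∀ ω, 0 ≤ Z ω) (hZi : Integrable Z μ) :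
    ∫ ω, Z ω * Real.exp (l * X ω) ∂μ ≤ Real.exp (l * f + l ^ 2 * Δ ^ 2 / 8) * ∫ ω, Z ω ∂μ := by
  have hXb : ∀ᵐ ω ∂μ, ‖X ω‖ ≤ |a| + Δ := ae_of_all _ fun ω => by
    rw [Real.norm_eq_abs, abs_le]
    have := hb ω; constructor <;> linarith [this.1, this.2, neg_abs_le a, le_abs_self a]
  have hXi : Integrable X μ := Integrable.of_bound hX.aestronglyMeasurable _ hXb
  have ha0 : a ≤ 0 := by
    have := integral_mono (μ := μ) (integrable_const a) hXi (fun ω => (hb ω).1)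
    simpa [hc] using this
  have hb0 : 0 ≤ a + Δ := by
    have := integral_mono (μ := μ) hXi (integrable_const (a + Δ)) (fun ω => (hb ω).2)
    simpa [hc] using this
  have hce : ∀ᵐ ω ∂μ, (μ[X | m]) ω ≤ min f (a + Δ) := by
    have h1 : μ[X | m] ≤ᵐ[μ] μ[(fun _ => a + Δ : Ω → ℝ) | m] :=
      condExp_mono hXi (integrable_const _) (ae_of_all _ fun ω => (hb ω).2)
    rw [condExp_const hm] at h1
    filter_upwards [hmix, h1] with ω h h' using le_min h h'
  obtain ⟨α, β, hβ, hch, hle⟩ := two_point a Δ (min f (a + Δ)) l hΔ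
    ⟨le_min (ha0.trans hf) (by linarith), min_le_right _ _⟩ hl
  have hZX : Integrable (fun ω => Z ω * X ω) μ := hZi.mul_bdd hX.aestronglyMeasurable hXb
  have hpull : μ[(Z * X) | m] =ᵐ[μ] Z * μ[X | m] :=
    condExp_mul_of_stronglyMeasurable_left hZ.stronglyMeasurable hZX hXi
  have key : ∫ ω, Z ω * X ω ∂μ ≤ min f (a + Δ) * ∫ ω, Z ω ∂μ := by
    have e : ∫ ω, Z ω * X ω ∂μ = ∫ ω, (μ[(Z * X) | m]) ω ∂μ := (integral_condExp hm).symm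
    rw [e, ← integral_const_mul]
    refine integral_mono_ae integrable_condExp (hZi.const_mul _) ?_
    filter_upwards [hpull, hce] with ω h1 h2
    rw [h1, Pi.mul_apply, mul_comm]
    exact mul_le_mul_of_nonneg_right h2 (hZ0 ω)
  have hI0 : 0 ≤ ∫ ω, Z ω ∂μ := integral_nonneg hZ0
  calc ∫ ω, Z ω * Real.exp (l * X ω) ∂μ ≤ ∫ ω, (α * Z ω + β * (Z ω * X ω)) ∂μ := by
        refine integral_mono_of_nonneg (ae_of_all _ fun ω => mul_nonneg (hZ0 ω) (Real.exp_pos _).le)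
          ((hZi.const_mul _).add (hZX.const_mul _)) (ae_of_all _ fun ω => ?_)
        have := mul_le_mul_of_nonneg_left (hch _ (hb ω)) (hZ0 ω)
        simp only; linarith
    _ = α * ∫ ω, Z ω ∂μ + β * ∫ ω, Z ω * X ω ∂μ := by
        rw [integral_add (hZi.const_mul _) (hZX.const_mul _), integral_const_mul, integral_const_mul]
    _ ≤ (α + β * min f (a + Δ)) * ∫ ω, Z ω ∂μ := by
        have := mul_le_mul_of_nonneg_left key hβ
        linarith
    _ ≤ _ := by
        refine mul_le_mul_of_nonneg_right (hle.trans (Real.exp_le_exp.2 ?_)) hI0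
        have := mul_le_mul_of_nonneg_left (min_le_left f (a + Δ)) hl
        linarith

/-- exponential of the sum is bounded, hence integrable -/
lemma exp_integrable {V Ω : Type*} [MeasurableSpace Ω] (μ : Measure Ω)
    [IsProbabilityMeasure μ] (X : V → Ω → ℝ) (hX : ∀ v, Measurable (X v)) (a Δ f l : ℝ)
    (hb : ∀ v ω, X v ω ∈ Set.Icc a (a + Δ)) (hl : 0 ≤ l) (S : Finset V) :
    Integrable (fun ω => Real.exp (l * ∑ v ∈ S, (X v ω - f))) μ := by
  refine Integrable.of_bound (by fun_prop) (Real.exp (l * ∑ v ∈ S, (a + Δ - f))) (ae_of_all _ fun ω => ?_)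
  rw [Real.norm_eq_abs, Real.abs_exp]
  refine Real.exp_le_exp.2 (mul_le_mul_of_nonneg_left (Finset.sum_le_sum fun v _ => ?_) hl)
  linarith [(hb v ω).2]

lemma stable_mgf {V : Type*} [DecidableEq V] (G : SimpleGraph V)
    {Ω : Type*} [MeasurableSpace Ω] (μ : Measure Ω) [IsProbabilityMeasure μ]
    (X : V → Ω → ℝ) (hX_meas : ∀ v, Measurable (X v))
    (Δ a : ℝ) (hΔ : 0 < Δ)
    (hX_bdd : ∀ v ω, X v ω ∈ Set.Icc a (a + Δ))
    (hX_centered : ∀ v, ∫ ω, X v ω ∂μ = 0)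
    (f : ℝ) (hf : 0 ≤ f) (d : ℕ)
    (hmix : ∀ (v : V),
      ∀ᵐ ω ∂μ,
        (μ[X v | ⨆ (u : V) (_ : (d : ℕ∞) ≤ G.edist u v),
            MeasurableSpace.comap (X u) inferInstance]) ω ≤ f)
    (l : ℝ) (hl : 0 ≤ l)
    (S : Finset V) (hS : ∀ u ∈ S, ∀ u' ∈ S, u ≠ u' → (d : ℕ∞) ≤ G.edist u u') :
    ∫ ω, Real.exp (l * ∑ v ∈ S, (X v ω - f)) ∂μ ≤ Real.exp (l ^ 2 * S.card * Δ ^ 2 / 8) := by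
  induction S using Finset.induction_on with
  | empty => simp
  | insert v S hv ih =>
    have ih' := ih (fun u hu u' hu' => hS u (by simp [hu]) u' (by simp [hu']))
    have hle : (⨆ (u : V) (_ : (d : ℕ∞) ≤ G.edist u v),
            MeasurableSpace.comap (X u) inferInstance) ≤ (inferInstance : MeasurableSpace Ω) :=
      iSup₂_le fun u _ => (hX_meas u).comap_le
    have hZ : Measurable[⨆ (u : V) (_ : (d : ℕ∞) ≤ G.edist u v),
            MeasurableSpace.comap (X u) inferInstance]
            (fun ω => Real.exp (l * ∑ u ∈ S, (X u ω - f))) := by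
      refine Real.measurable_exp.comp (Measurable.const_mul (Finset.measurable_fun_sum _ fun u hu => ?_) l)
      refine Measurable.sub_const ?_ f
      have h1 : MeasurableSpace.comap (X u) inferInstance ≤ ⨆ (u : V) (_ : (d : ℕ∞) ≤ G.edist u v),
            MeasurableSpace.comap (X u) inferInstance :=
        le_iSup₂_of_le u (hS u (by simp [hu]) v (by simp) (fun h => hv (h ▸ hu))) le_rfl
      exact (comap_measurable (X u)).mono h1 le_rfl
    have hs := step hle μ (X v) _ (hX_meas v) a Δ f l hΔ (hX_bdd v) (hX_centered v) hf (hmix v) hl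
      hZ (fun _ => (Real.exp_pos _).le) (exp_integrable μ X hX_meas a Δ f l hX_bdd hl S)
    have e : ∀ ω, Real.exp (l * ∑ u ∈ insert v S, (X u ω - f)) =
        Real.exp (-(l * f)) * (Real.exp (l * ∑ u ∈ S, (X u ω - f)) * Real.exp (l * X v ω)) := by
      intro ω
      rw [Finset.sum_insert hv, ← Real.exp_add, ← Real.exp_add]; ring_nf
    simp_rw [e]
    rw [integral_const_mul]
    calc _ ≤ Real.exp (-(l * f)) * (Real.exp (l * f + l ^ 2 * Δ ^ 2 / 8) * Real.exp (l ^ 2 * S.card * Δ ^ 2 / 8)) := by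
          refine mul_le_mul_of_nonneg_left (hs.trans ?_) (Real.exp_pos _).le
          exact mul_le_mul_of_nonneg_left ih' (Real.exp_pos _).le
      _ = _ := by
          rw [← Real.exp_add, ← Real.exp_add, Finset.card_insert_of_notMem hv]
          push_cast; ring_nf

lemma div_mul_le_of_nonneg_aux {x y : ℝ} (hx : 0 ≤ x) (_hy : 0 ≤ y) : x / y * y ≤ x := by
  rcases eq_or_ne y 0 with h | h
  · simp [h, hx]
  · rw [div_mul_cancel₀ _ h]



/-- **Chernoff tail bound for (G,φ)-mixing processes** (from the proof of Proposition 1):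
for a `(G,φ)`-mixing process bounded in an interval of length `Δ` and a `d`-stable fractional
partition of total weight `Wt`, for every `t > φ_d`,
`P((1/n) ∑_v X_v ≥ t) ≤ exp(−2n (t − φ_d)² / (Δ² Wt))`. -/
theorem graph_mixing_tail_bound
    {V : Type*} [Fintype V] [DecidableEq V] (G : SimpleGraph V)
    (n : ℕ) (hn : Fintype.card V = n)
    {Ω : Type*} [MeasurableSpace Ω] (μ : Measure Ω) [IsProbabilityMeasure μ]
    (X : V → Ω → ℝ) (hX_meas : ∀ v, Measurable (X v))
    (Δ a : ℝ) (hΔ : 0 ≤ Δ)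
    (hX_bdd : ∀ v ω, X v ω ∈ Set.Icc a (a + Δ))
    (hX_centered : ∀ v, ∫ ω, X v ω ∂μ = 0)
    (φ : ℕ → ℝ) (hφ_nonneg : ∀ d, 0 ≤ φ d) (hφ_mono : Antitone φ)
    (hmix : ∀ (v : V) (d : ℕ), 1 ≤ d →
      ∀ᵐ ω ∂μ,
        (μ[X v | ⨆ (u : V) (_ : (d : ℕ∞) ≤ G.edist u v),
            MeasurableSpace.comap (X u) inferInstance]) ω ≤ φ d)
    (d : ℕ) (hd1 : 1 ≤ d) (hdn : d ≤ n)
    (K : ℕ) (w : Fin K → ℝ) (S : Fin K → Finset V)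
    (hw_nonneg : ∀ k, 0 ≤ w k)
    (hS_stable : ∀ k, ∀ u ∈ S k, ∀ u' ∈ S k, u ≠ u' → (d : ℕ∞) ≤ G.edist u u')
    (hpartition : ∀ v : V, ∑ k : Fin K, w k * (if v ∈ S k then (1 : ℝ) else 0) = 1)
    (Wt : ℝ) (hWt : Wt = ∑ k : Fin K, w k)
    (t : ℝ) (ht : φ d < t) :
    μ {ω | t ≤ (1 / (n : ℝ)) * ∑ v : V, X v ω} ≤
      ENNReal.ofReal (Real.exp (-(2 * n * (t - φ d) ^ 2) / (Δ ^ 2 * Wt))) := by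
  rcases hΔ.eq_or_lt with h0 | hΔ'
  · subst h0
    simpa using prob_le_one
  have hn0 : 0 < (n : ℝ) := by exact_mod_cast (by omega : 0 < n)
  have hpart : ∀ g : V → ℝ, ∑ k, w k * ∑ v ∈ S k, g v = ∑ v, g v := by
    intro g
    calc ∑ k, w k * ∑ v ∈ S k, g v
        = ∑ k, ∑ v, (w k * (if v ∈ S k then (1 : ℝ) else 0)) * g v := by
          refine Finset.sum_congr rfl fun k _ => ?_
          have hg : ∑ v ∈ S k, g v = ∑ v, if v ∈ S k then g v else 0 := by simp
          rw [hg, Finset.mul_sum]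
          refine Finset.sum_congr rfl fun v _ => ?_
          split_ifs <;> simp
      _ = ∑ v, g v := by
          rw [Finset.sum_comm]
          refine Finset.sum_congr rfl fun v _ => ?_
          rw [← Finset.sum_mul, hpartition, one_mul]
  have hcard : ∑ k, w k * ((S k).card : ℝ) = n := by
    have := hpart (fun _ => 1)
    simpa [hn] using this
  set f := φ d with hf
  set T : ℝ := ∑ k, w k * √((S k).card : ℝ) with hT
  have hT2 : T ^ 2 ≤ Wt * n := by
    have := Finset.sum_mul_sq_le_sq_mul_sq Finset.univ (fun k => √(w k))
      (fun k => √(w k) * √((S k).card : ℝ))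
    have e1 : ∀ k, √(w k) * (√(w k) * √((S k).card : ℝ)) = w k * √((S k).card : ℝ) := by
      intro k; rw [← mul_assoc, Real.mul_self_sqrt (hw_nonneg k)]
    have e2 : ∀ k, (√(w k) * √((S k).card : ℝ)) ^ 2 = w k * ((S k).card : ℝ) := by
      intro k; rw [mul_pow, Real.sq_sqrt (hw_nonneg k), Real.sq_sqrt (Nat.cast_nonneg _)]
    simp only [e1, e2, Real.sq_sqrt (hw_nonneg _)] at this
    rw [hcard, ← hWt] at this
    exact this
  have hTnn : ∀ k, 0 ≤ w k * √((S k).card : ℝ) := fun k =>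
    mul_nonneg (hw_nonneg k) (Real.sqrt_nonneg _)
  have hTpos : 0 < T := by
    refine (Finset.sum_nonneg fun k _ => hTnn k).lt_of_ne fun h => ?_
    have hz := (Finset.sum_eq_zero_iff_of_nonneg fun k _ => hTnn k).1 h.symm
    have : ∑ k, w k * ((S k).card : ℝ) = 0 := Finset.sum_eq_zero fun k hk => by
      have := hz k hk
      rcases mul_eq_zero.1 this with h | h
      · simp [h]
      · rw [Real.sqrt_eq_zero (Nat.cast_nonneg _)] at h; simp [h]
    linarith
  have hWpos : 0 < Wt := by
    by_contra hneg
    have : 0 < T ^ 2 := by positivity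
    nlinarith
  set s := t - f with hs
  have hspos : 0 < s := by linarith
  set l : ℝ := 4 * s / (Wt * Δ ^ 2) with hl
  have hlpos : 0 ≤ l := by positivity
  let q : Fin K → ℝ := fun k => l * T / √((S k).card : ℝ)
  have hq0 : ∀ k, 0 ≤ q k := fun k => by positivity
  have hmgf : ∫ ω, Real.exp (l * ∑ v, (X v ω - f)) ∂μ ≤ Real.exp (l ^ 2 * (Wt * n) * Δ ^ 2 / 8) := by
    have hpt : ∀ ω, Real.exp (l * ∑ v, (X v ω - f)) ≤
        ∑ k, (w k * √((S k).card : ℝ) / T) * Real.exp (q k * ∑ v ∈ S k, (X v ω - f)) := by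
      intro ω
      have h := convexOn_exp.map_sum_le (t := Finset.univ)
        (w := fun k => w k * √((S k).card : ℝ) / T)
        (p := fun k => q k * ∑ v ∈ S k, (X v ω - f))
        (fun k _ => div_nonneg (hTnn k) hTpos.le)
        (by rw [← Finset.sum_div]; exact div_self hTpos.ne') (fun k _ => Set.mem_univ _)
      simp only [smul_eq_mul] at h
      refine le_trans (le_of_eq ?_) h
      rw [← hpart, Finset.mul_sum]
      congr 1
      refine Finset.sum_congr rfl fun k _ => ?_
      rcases (S k).eq_empty_or_nonempty with he | he
      · simp [he]
      · have : 0 < √((S k).card : ℝ) := Real.sqrt_pos.2 (by exact_mod_cast he.card_pos)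
        simp only [q]
        field_simp
    have hI : ∀ k, Integrable (fun ω => (w k * √((S k).card : ℝ) / T) *
        Real.exp (q k * ∑ v ∈ S k, (X v ω - f))) μ := fun k =>
      (exp_integrable μ X hX_meas a Δ f (q k) hX_bdd (hq0 k) (S k)).const_mul _
    calc _ ≤ ∫ ω, ∑ k, (w k * √((S k).card : ℝ) / T) *
          Real.exp (q k * ∑ v ∈ S k, (X v ω - f)) ∂μ :=
          integral_mono (exp_integrable μ X hX_meas a Δ f l hX_bdd hlpos _)
            (integrable_finsetSum _ fun k _ => hI k) hpt
      _ = ∑ k, (w k * √((S k).card : ℝ) / T) *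
          ∫ ω, Real.exp (q k * ∑ v ∈ S k, (X v ω - f)) ∂μ := by
          rw [integral_finsetSum _ fun k _ => hI k]
          simp_rw [integral_const_mul]
      _ ≤ ∑ k, (w k * √((S k).card : ℝ) / T) * Real.exp (l ^ 2 * (Wt * n) * Δ ^ 2 / 8) := by
          refine Finset.sum_le_sum fun k _ =>
            mul_le_mul_of_nonneg_left ?_ (div_nonneg (hTnn k) hTpos.le)
          refine (stable_mgf G μ X hX_meas Δ a hΔ' hX_bdd hX_centered f (hφ_nonneg d) d
            (fun v => hmix v d hd1) (q k) (hq0 k) (S k) (hS_stable k)).trans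
            (Real.exp_le_exp.2 ?_)
          have hqk : q k ^ 2 * ((S k).card : ℝ) ≤ l ^ 2 * T ^ 2 := by
            simp only [q]
            rw [div_pow, Real.sq_sqrt (Nat.cast_nonneg _), mul_pow]
            exact div_mul_le_of_nonneg_aux (by positivity) (by positivity)
          have h2 : l ^ 2 * T ^ 2 ≤ l ^ 2 * (Wt * n) := mul_le_mul_of_nonneg_left hT2 (sq_nonneg l)
          have h3 := mul_le_mul_of_nonneg_right (hqk.trans h2) (sq_nonneg Δ)
          linarith
      _ = _ := by
          rw [← Finset.sum_mul, ← Finset.sum_div, div_self hTpos.ne', one_mul]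
  have hset : {ω | t ≤ (1 / (n : ℝ)) * ∑ v : V, X v ω} = {ω | n * s ≤ ∑ v, (X v ω - f)} := by
    ext ω
    simp only [Set.mem_ofPred_eq, Finset.sum_sub_distrib, Finset.sum_const, Finset.card_univ, hn,
      nsmul_eq_mul]
    rw [one_div, inv_mul_eq_div, le_div_iff₀ hn0, hs]
    constructor <;> intro h <;> linarith
  have hch := ProbabilityTheory.measure_ge_le_exp_mul_mgf (μ := μ)
    (X := fun ω => ∑ v, (X v ω - f)) (n * s) hlpos
    (exp_integrable μ X hX_meas a Δ f l hX_bdd hlpos _)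
  rw [hset, ← ofReal_measureReal]
  refine ENNReal.ofReal_le_ofReal (hch.trans ?_)
  refine (mul_le_mul_of_nonneg_left hmgf (Real.exp_pos _).le).trans (le_of_eq ?_)
  rw [← Real.exp_add]
  congr 1
  rw [hl]
  field_simp
  ring
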